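/- Let E = (E^0, E^1, r, s) be a topological graph. Fix an open set U ⊆ E^* and a compact set K ⊆ E^* with Z(U) ∩ Z(K)^c ≠ ∅, and write K ⊆ ⋃_{i=0}^{k} E^i for some k ≥ 0. Then for every boundary path μ ∈ Z(U) ∩ Z(K)^c with |μ| = k there exists an open subset V of E^{|μ|} (an open neighborhood of μ in E^{|μ|}) such that μ ∈ Z(V) ⊆ Z(U) ∩ Z(K)^c. -/

import Mathlib

/-- A locally compact Hausdorff space is *totally disconnected* (in the sense used for
topological graphs) if it has an open base consisting of compact open subsets. -/
def TotallyDisc (T : Type) [TopologicalSpace T] : Prop :=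
  ∀ (t : T) (U : Set T), IsOpen U → t ∈ U →
    ∃ W : Set T, IsCompact W ∧ IsOpen W ∧ t ∈ W ∧ W ⊆ U

/-- A topological graph `E = (E⁰, E¹, r, s)`: `r` continuous, `s` a local homeomorphism. -/
structure TopGraph (V E : Type) [TopologicalSpace V] [TopologicalSpace E] where
  r : E → V
  s : E → V
  cont_r : Continuous r
  locHomeo_s : IsLocalHomeomorph s

namespace TopGraph

variable {V E : Type} [TopologicalSpace V] [TopologicalSpace E] (G : TopGraph V E)

/-- Compatibility condition for a finite sequence of edges to be a path. -/
def PathCond (n : ℕ) (μ : Fin n → E) : Prop :=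
  ∀ (i : ℕ) (h : i + 1 < n), G.s (μ ⟨i, Nat.lt_of_succ_lt h⟩) = G.r (μ ⟨i + 1, h⟩)

/-- The space `Eⁿ` of paths of length `n`; paths of length `0` are vertices. -/
def PathN : ℕ → Type
  | 0 => V
  | n + 1 => { μ : Fin (n + 1) → E // G.PathCond (n + 1) μ }

instance pathNTop : (n : ℕ) → TopologicalSpace (G.PathN n)
  | 0 => inferInstanceAs (TopologicalSpace V)
  | n + 1 => inferInstanceAs (TopologicalSpace { μ : Fin (n + 1) → E // G.PathCond (n + 1) μ })

/-- The finite path space `E* = ⨿ₙ Eⁿ` with the disjoint union topology. -/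
def FinPath : Type := (n : ℕ) × G.PathN n

instance : TopologicalSpace G.FinPath := inferInstanceAs (TopologicalSpace ((n : ℕ) × G.PathN n))

/-- The range `r(μ)` of a finite path. -/
def pathRange : (n : ℕ) → G.PathN n → V
  | 0, v => v
  | _ + 1, μ => G.r (μ.1 ⟨0, Nat.succ_pos _⟩)

/-- The source `s(μ)` of a finite path. -/
def pathSource : (n : ℕ) → G.PathN n → V
  | 0, v => v
  | n + 1, μ => G.s (μ.1 ⟨n, Nat.lt_succ_self n⟩)

/-- The `i`-th edge of a finite path (`none` if out of range); `0`-indexed. -/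
def pathEdge : (n : ℕ) → G.PathN n → ℕ → Option E
  | 0, _, _ => none
  | n + 1, μ, i => if h : i < n + 1 then some (μ.1 ⟨i, h⟩) else none

/-- `E⁰_sce = E⁰ \ cl (r(E¹))`. -/
def sce : Set V := {v | v ∉ closure (Set.range G.r)}

/-- `E⁰_fin`: vertices with an open neighborhood `N` such that `r⁻¹(cl N)` is compact. -/
def finV : Set V := {v | ∃ N : Set V, IsOpen N ∧ v ∈ N ∧ IsCompact (G.r ⁻¹' closure N)}

/-- `E⁰_rg = E⁰_fin \ cl (E⁰_sce)`. -/
def rg : Set V := G.finV \ closure G.sce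

/-- `E⁰_sg = E⁰ \ E⁰_rg`. -/
def sg : Set V := {v | v ∉ G.rg}

/-- The infinite path space `E^∞`. -/
def InfPath : Type := { μ : ℕ → E // ∀ i : ℕ, G.s (μ i) = G.r (μ (i + 1)) }

/-- The boundary path space `∂E = E^∞ ⨿ {μ ∈ E* : s(μ) ∈ E⁰_sg}`. -/
def BoundaryPath : Type :=
  G.InfPath ⊕ { α : G.FinPath // G.pathSource α.1 α.2 ∈ G.sg }

/-- The finite boundary path determined by a finite path whose source is singular. -/
def mkFin (α : G.FinPath) (h : G.pathSource α.1 α.2 ∈ G.sg) : G.BoundaryPath :=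
  Sum.inr ⟨α, h⟩

/-- The length of a boundary path, in `ℕ∞`. -/
def bLen : G.BoundaryPath → ℕ∞
  | Sum.inl _ => ⊤
  | Sum.inr α => (α.1.1 : ℕ∞)

/-- The `i`-th edge of a boundary path. -/
def bEdge : G.BoundaryPath → ℕ → Option E
  | Sum.inl μ, i => some (μ.1 i)
  | Sum.inr α, i => G.pathEdge α.1.1 α.1.2 i

/-- The range vertex of a boundary path. -/
def bRange : G.BoundaryPath → V
  | Sum.inl μ => G.r (μ.1 0)
  | Sum.inr α => G.pathRange α.1.1 α.1.2

/-- `α ∈ E*` is an initial segment of the boundary path `μ`, i.e. `μ = αβ`. -/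
def IsPrefix (α : G.FinPath) (μ : G.BoundaryPath) : Prop :=
  G.pathRange α.1 α.2 = G.bRange μ ∧
    ∀ i : ℕ, i < α.1 → G.bEdge μ i = G.pathEdge α.1 α.2 i

/-- The cylinder set `Z(S) ⊆ ∂E` of a set `S ⊆ E*`. -/
def cyl (S : Set G.FinPath) : Set G.BoundaryPath :=
  {μ | ∃ α ∈ S, G.IsPrefix α μ}

/-- The topology on `∂E`, generated by the sets `Z(U) ∩ Z(K)ᶜ` with `U` open, `K` compact. -/
instance : TopologicalSpace G.BoundaryPath :=
  TopologicalSpace.generateFrom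
    {W | ∃ (U K : Set G.FinPath), IsOpen U ∧ IsCompact K ∧ W = G.cyl U ∩ (G.cyl K)ᶜ}

/-- Removing the first edge of a path of length `n + 1`. -/
def pathTail : (n : ℕ) → G.PathN (n + 1) → G.PathN n
  | 0, μ => G.s (μ.1 ⟨0, Nat.one_pos⟩)
  | n + 1, μ => ⟨fun i => μ.1 ⟨i.1 + 1, by omega⟩, fun i h => μ.2 (i + 1) (by omega)⟩

theorem pathSource_pathTail : ∀ (n : ℕ) (μ : G.PathN (n + 1)),
    G.pathSource n (G.pathTail n μ) = G.pathSource (n + 1) μ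
  | 0, μ => rfl
  | n + 1, μ => rfl

/-- The one-sided shift `σ` on `∂E` (the identity on paths of length `0`,
where it is undefined). -/
def shift : G.BoundaryPath → G.BoundaryPath
  | Sum.inl μ => Sum.inl ⟨fun i => μ.1 (i + 1), fun i => μ.2 (i + 1)⟩
  | Sum.inr α =>
    match α with
    | ⟨⟨0, v⟩, h⟩ => Sum.inr ⟨⟨0, v⟩, h⟩
    | ⟨⟨n + 1, μ⟩, h⟩ =>
        Sum.inr ⟨⟨n, G.pathTail n μ⟩, by rw [G.pathSource_pathTail]; exact h⟩

/-- The Renault–Deaconu relation of the boundary path groupoid `Γ(∂E, σ)`: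
`(μ, n, ν)` is an element of the groupoid. -/
def bRD (μ : G.BoundaryPath) (n : ℤ) (ν : G.BoundaryPath) : Prop :=
  ∃ k l : ℕ, n = (k : ℤ) - (l : ℤ) ∧ (k : ℕ∞) ≤ G.bLen μ ∧ (l : ℕ∞) ≤ G.bLen ν ∧
    G.shift^[k] μ = G.shift^[l] ν

/-- The boundary path groupoid `Γ(∂E, σ)` as a set of triples. -/
def BPGroupoid : Type :=
  { x : G.BoundaryPath × ℤ × G.BoundaryPath // G.bRD x.1 x.2.1 x.2.2 }

/-- The range map of the boundary path groupoid. -/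
def gR (x : G.BPGroupoid) : G.BoundaryPath := x.1.1

/-- The source map of the boundary path groupoid. -/
def gS (x : G.BPGroupoid) : G.BoundaryPath := x.1.2.2

/-- The topology on `Γ(∂E, σ)` generated by the basic open sets `𝒰(U, V, k, l)`. -/
instance : TopologicalSpace G.BPGroupoid :=
  TopologicalSpace.generateFrom
    {W | ∃ (U Vs : Set G.BoundaryPath) (k l : ℕ),
      IsOpen U ∧ IsOpen Vs ∧
      (∀ μ ∈ U, (k : ℕ∞) ≤ G.bLen μ) ∧ (∀ μ ∈ Vs, (l : ℕ∞) ≤ G.bLen μ) ∧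
      Set.InjOn (G.shift^[k]) U ∧ Set.InjOn (G.shift^[l]) Vs ∧
      W = {x : G.BPGroupoid | G.gR x ∈ U ∧ G.gS x ∈ Vs ∧ x.1.2.1 = (k : ℤ) - (l : ℤ) ∧
        G.shift^[k] (G.gR x) = G.shift^[l] (G.gS x)}}

/-- A unit `μ ∈ ∂E` has trivial isotropy in `Γ(∂E, σ)`. -/
def TrivialIsotropy (μ : G.BoundaryPath) : Prop :=
  ∀ n : ℤ, G.bRD μ n μ → n = 0

/-- `E` is essentially free: the units with trivial isotropy are dense in `∂E`. -/
def EssentiallyFree : Prop := Dense {μ : G.BoundaryPath | G.TrivialIsotropy μ}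

/-- `N ⊆ Γ(∂E, σ)` is a bisection: the source and range maps restrict to homeomorphisms
of `N` onto their images. -/
def IsBisection (N : Set G.BPGroupoid) : Prop :=
  Topology.IsEmbedding (N.restrict G.gS) ∧ Topology.IsEmbedding (N.restrict G.gR)

/-- The boundary path groupoid `Γ(∂E, σ)` is locally contracting
(Anantharaman-Delaroche): for every nonempty open `U` in the unit space `∂E` there are an
open `V ⊆ U` and an open bisection `N` with `cl V ⊆ s(N)` and
`s((r|_{N⁻¹})⁻¹(cl V)) ⊊ V`. -/
def BPLocallyContracting : Prop :=
  ∀ U : Set G.BoundaryPath, IsOpen U → U.Nonempty →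
    ∃ (Vs : Set G.BoundaryPath) (N : Set G.BPGroupoid),
      IsOpen Vs ∧ Vs ⊆ U ∧ IsOpen N ∧ G.IsBisection N ∧
      closure Vs ⊆ G.gS '' N ∧
      G.gR '' (N ∩ {x | G.gS x ∈ closure Vs}) ⊂ Vs

/-- `μ` is a cycle: a path of length `n + 1 ≥ 1` with `r(μ) = s(μ)`. -/
def IsCycle (n : ℕ) (μ : G.PathN (n + 1)) : Prop :=
  G.pathRange (n + 1) μ = G.pathSource (n + 1) μ

/-- The cycle `μ` has no entrances: `r⁻¹(r(μᵢ)) = {μᵢ}` for all `i`. -/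
def NoEntrances (n : ℕ) (μ : G.PathN (n + 1)) : Prop :=
  ∀ (i : Fin (n + 1)) (e : E), G.r e = G.r (μ.1 i) → e = μ.1 i

/-- The cycle `μ` has entrances. -/
def HasEntrances (n : ℕ) (μ : G.PathN (n + 1)) : Prop := ¬ G.NoEntrances n μ

/-- `E` is topologically free: the set of base points of cycles without entrances has
empty interior. -/
def TopologicallyFree : Prop :=
  interior {v : V | ∃ (n : ℕ) (μ : G.PathN (n + 1)),
    G.IsCycle n μ ∧ G.NoEntrances n μ ∧ G.pathRange (n + 1) μ = v} = ∅

/-- The positive orbit space `Orb⁺(v)` of a vertex. -/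
def orb (v : V) : Set V :=
  {w | ∃ (n : ℕ) (ν : G.PathN n), G.pathRange n ν = w ∧ G.pathSource n ν = v}

/-- `Orb⁺(r(μ)) ∪ ⋃ᵢ Orb⁺(s(μᵢ))` for a boundary path `μ`. -/
def cofinalSet (μ : G.BoundaryPath) : Set V :=
  G.orb (G.bRange μ) ∪ {w | ∃ (i : ℕ) (e : E), G.bEdge μ i = some e ∧ w ∈ G.orb (G.s e)}

/-- `E` is cofinal. -/
def Cofinal : Prop := ∀ μ : G.BoundaryPath, Dense (G.cofinalSet μ)

/-- Every open neighborhood `N` of `μ` in `E^{|μ|}` contains an open neighborhood `U` of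
`μ` with `r^{|μ|}(U) ⊆ s^{|μ|}(U)`. -/
def NbhdContracting (n : ℕ) (μ : G.PathN (n + 1)) : Prop :=
  ∀ N : Set (G.PathN (n + 1)), IsOpen N → μ ∈ N →
    ∃ U : Set (G.PathN (n + 1)), IsOpen U ∧ μ ∈ U ∧ U ⊆ N ∧
      G.pathRange (n + 1) '' U ⊆ G.pathSource (n + 1) '' U

/-- The set `B` of vertices which connect to a cycle `μ` with entrances such that every
open neighborhood of `μ` contains an open neighborhood `U` of `μ` with
`r^{|μ|}(U) ⊆ s^{|μ|}(U)`. -/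
def Bset : Set V :=
  {v | ∃ (n : ℕ) (μ : G.PathN (n + 1)), G.IsCycle n μ ∧ G.HasEntrances n μ ∧
    v ∈ G.orb (G.pathRange (n + 1) μ) ∧ G.NbhdContracting n μ}

/-- Truncation of a path of length `n + 1` to its first `m + 1` edges (`m ≤ n`). -/
def pathTrunc (m n : ℕ) (h : m ≤ n) (μ : G.PathN (n + 1)) : G.PathN (m + 1) :=
  ⟨fun i => μ.1 ⟨i.1, by omega⟩, fun i hi => μ.2 i (by omega)⟩

/-- The conditions on a finite family `{Uᵢ ⊆ E^{nᵢ+1}}` witnessing that `Vset` is a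
contracting open set in the sense of Katsura. -/
def ContractingWitness (Vset : Set V) (k : ℕ) (nf : Fin k → ℕ)
    (U : ∀ i : Fin k, Set (G.PathN (nf i + 1))) : Prop :=
  (∀ i, (U i).Nonempty ∧ IsOpen (U i)) ∧
  (∀ i, ∀ μ ∈ U i, G.pathRange (nf i + 1) μ ∈ Vset) ∧
  (∀ i j, i ≠ j → ∀ h : nf i ≤ nf j, ∀ μ ∈ U j, G.pathTrunc (nf i) (nf j) h μ ∉ U i) ∧
  closure Vset ⊂ ⋃ i, (G.pathSource (nf i + 1)) '' U i

/-- `Vset ⊆ E⁰` is a contracting open set in the sense of Katsura. -/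
def IsContractingSet (Vset : Set V) : Prop :=
  Vset.Nonempty ∧ IsOpen Vset ∧ IsCompact (closure Vset) ∧
    ∃ (k : ℕ) (nf : Fin k → ℕ) (U : ∀ i : Fin k, Set (G.PathN (nf i + 1))),
      G.ContractingWitness Vset k nf U

/-- `E` is contracting at the vertex `v`. -/
def ContractingAt (v : V) : Prop :=
  Dense (G.orb v) ∧ ∀ N : Set V, IsOpen N → v ∈ N →
    ∃ W : Set V, W ⊆ N ∧ G.IsContractingSet W

/-- `E` is a contracting topological graph. -/
def Contracting : Prop := ∃ v : V, G.ContractingAt v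

end TopGraph

namespace TopGraph

section Truncation

variable {V E : Type} [TopologicalSpace V] [TopologicalSpace E] (G : TopGraph V E)

/-- The initial segment of length `m` of a path of length `n`, for `m ≤ n`. -/
def initSeg : (m n : ℕ) → m ≤ n → G.PathN n → G.PathN m
  | 0, n, _, q => G.pathRange n q
  | m + 1, n + 1, h, q => G.pathTrunc m n (Nat.le_of_succ_le_succ h) q

theorem continuous_pathRange : (n : ℕ) → Continuous (G.pathRange n)
  | 0 => continuous_id
  | _ + 1 => G.cont_r.comp ((continuous_apply _).comp continuous_subtype_val)

theorem continuous_initSeg : (m n : ℕ) → (h : m ≤ n) → Continuous (G.initSeg m n h)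
  | 0, n, _ => G.continuous_pathRange n
  | m + 1, n + 1, _ =>
    Continuous.subtype_mk (f := fun (q : G.PathN (n + 1)) (i : Fin (m + 1)) => q.1 ⟨i.1, by omega⟩)
      (continuous_pi fun i => (continuous_apply (⟨i.1, by omega⟩ : Fin (n + 1))).comp
        continuous_subtype_val) _

instance t2Space_pathN [T2Space V] [T2Space E] : (n : ℕ) → T2Space (G.PathN n)
  | 0 => inferInstanceAs (T2Space V)
  | n + 1 => inferInstanceAs (T2Space { μ : Fin (n + 1) → E // G.PathCond (n + 1) μ })

instance t2Space_finPath [T2Space V] [T2Space E] : T2Space G.FinPath :=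
  inferInstanceAs (T2Space ((n : ℕ) × G.PathN n))

theorem continuous_sigmaMk_finPath (n : ℕ) :
    Continuous (fun q : G.PathN n => (⟨n, q⟩ : G.FinPath)) :=
  continuous_sigmaMk (σ := G.PathN)

theorem pathRange_initSeg : (m n : ℕ) → (h : m ≤ n) → (q : G.PathN n) →
    G.pathRange m (G.initSeg m n h q) = G.pathRange n q
  | 0, _, _, _ => rfl
  | _ + 1, _ + 1, _, _ => rfl

theorem pathEdge_initSeg : (m n : ℕ) → (h : m ≤ n) → (q : G.PathN n) → (i : ℕ) → i < m →
    G.pathEdge m (G.initSeg m n h q) i = G.pathEdge n q i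
  | 0, _, _, _, _, hi => absurd hi (Nat.not_lt_zero _)
  | m + 1, n + 1, h, q, i, hi => by
    simp only [pathEdge, dif_pos hi, dif_pos (hi.trans_le h)]
    rfl

/-- A path is determined by its range and its edges. -/
theorem pathN_ext : (n : ℕ) → (a b : G.PathN n) → G.pathRange n a = G.pathRange n b →
    (∀ i < n, G.pathEdge n a i = G.pathEdge n b i) → a = b
  | 0, _, _, h, _ => h
  | n + 1, a, b, _, h => Subtype.ext <| funext fun i => by
    simpa only [pathEdge, dif_pos i.2, Option.some.injEq] using h i i.2

variable {G}

theorem IsPrefix.initSeg {n : ℕ} {q : G.PathN n} {ν : G.BoundaryPath}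
    (hq : G.IsPrefix ⟨n, q⟩ ν) {m : ℕ} (h : m ≤ n) :
    G.IsPrefix ⟨m, G.initSeg m n h q⟩ ν :=
  ⟨(G.pathRange_initSeg m n h q).trans hq.1, fun i hi =>
    (hq.2 i (lt_of_lt_of_le hi h)).trans (G.pathEdge_initSeg m n h q i hi).symm⟩

theorem IsPrefix.eq_initSeg {m n : ℕ} {a : G.PathN m} {q : G.PathN n} {ν : G.BoundaryPath}
    (ha : G.IsPrefix ⟨m, a⟩ ν) (hq : G.IsPrefix ⟨n, q⟩ ν) (h : m ≤ n) :
    a = G.initSeg m n h q :=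
  G.pathN_ext m _ _ (ha.1.trans (hq.initSeg h).1.symm) fun i hi =>
    (ha.2 i hi).symm.trans ((hq.initSeg h).2 i hi)

theorem isPrefix_mkFin (α : G.FinPath) (h : G.pathSource α.1 α.2 ∈ G.sg) :
    G.IsPrefix α (G.mkFin α h) :=
  ⟨rfl, fun _ _ => rfl⟩

theorem pathEdge_eq_none : (n : ℕ) → (q : G.PathN n) → G.pathEdge n q n = none
  | 0, _ => rfl
  | _ + 1, _ => dif_neg (lt_irrefl _)

theorem pathEdge_ne_none : (n : ℕ) → (q : G.PathN n) → (i : ℕ) → i < n →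
    G.pathEdge n q i ≠ none
  | 0, _, _, h => absurd h (Nat.not_lt_zero _)
  | _ + 1, _, _, h => by simp [pathEdge, h]

theorem IsPrefix.length_le {α β : G.FinPath} {h : G.pathSource β.1 β.2 ∈ G.sg}
    (hα : G.IsPrefix α (G.mkFin β h)) : α.1 ≤ β.1 := by
  by_contra! hlt
  exact pathEdge_ne_none α.1 α.2 β.1 hlt ((hα.2 β.1 hlt).symm.trans (pathEdge_eq_none β.1 β.2))

end Truncation

end TopGraph

/-- Lemma 3.1, second part: with `U ⊆ E*` open, `K ⊆ ⋃_{i=0}^k Eⁱ`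
compact and `Z(U) ∩ Z(K)ᶜ ≠ ∅`, every finite boundary path `μ ∈ Z(U) ∩ Z(K)ᶜ` of length
exactly `k` admits an open neighborhood `W` of `μ` in `E^{|μ|} = E^k` with
`μ ∈ Z(W) ⊆ Z(U) ∩ Z(K)ᶜ`. -/
theorem TopGraph.technical_lemma_one' {V E : Type}
    [TopologicalSpace V] [TopologicalSpace E]
    [SecondCountableTopology V] [SecondCountableTopology E]
    [LocallyCompactSpace V] [LocallyCompactSpace E] [T2Space V] [T2Space E]
    (G : TopGraph V E) (U K : Set G.FinPath) (hU : IsOpen U) (hK : IsCompact K)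
    (k : ℕ) (hKk : ∀ α ∈ K, α.1 ≤ k)
    (hne : (G.cyl U ∩ (G.cyl K)ᶜ).Nonempty)
    (p : G.PathN k) (hp : G.pathSource k p ∈ G.sg)
    (hμ : G.mkFin ⟨k, p⟩ hp ∈ G.cyl U ∩ (G.cyl K)ᶜ) :
    ∃ W : Set (G.PathN k), IsOpen W ∧ p ∈ W ∧
      G.mkFin ⟨k, p⟩ hp ∈ G.cyl (Sigma.mk k '' W) ∧
      G.cyl (Sigma.mk k '' W) ⊆ G.cyl U ∩ (G.cyl K)ᶜ := by
  obtain ⟨⟨⟨m, a⟩, haU, ha⟩, hpK⟩ := hμ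
  have hp' := isPrefix_mkFin ⟨k, p⟩ hp
  have hm : m ≤ k := ha.length_le
  have hopen (l : ℕ) (h : l ≤ k) {S : Set G.FinPath} (hS : IsOpen S) :
      IsOpen {q : G.PathN k | (⟨l, G.initSeg l k h q⟩ : G.FinPath) ∈ S} :=
    hS.preimage ((G.continuous_sigmaMk_finPath l).comp (G.continuous_initSeg l k h))
  let W : Set (G.PathN k) :=
    {q | (⟨m, G.initSeg m k hm q⟩ : G.FinPath) ∈ U} ∩
      ⋂ l : Fin (k + 1),
        {q | (⟨l, G.initSeg l k (Nat.le_of_lt_succ l.2) q⟩ : G.FinPath) ∈ Kᶜ}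
  have hpW : p ∈ W := by
    refine ⟨?_, Set.mem_iInter.2 fun l hl =>
      hpK ⟨_, hl, hp'.initSeg (Nat.le_of_lt_succ l.2)⟩⟩
    change (⟨m, G.initSeg m k hm p⟩ : G.FinPath) ∈ U
    rwa [← ha.eq_initSeg hp' hm]
  refine ⟨W, (hopen m hm hU).inter (isOpen_iInter_of_finite fun l =>
    hopen l (Nat.le_of_lt_succ l.2) hK.isClosed.isOpen_compl), hpW,
    ⟨_, ⟨p, hpW, rfl⟩, hp'⟩, ?_⟩
  rintro ν ⟨_, ⟨q, ⟨hqU, hqK⟩, rfl⟩, hq⟩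
  refine ⟨⟨_, hqU, hq.initSeg hm⟩, ?_⟩
  rintro ⟨⟨l, b⟩, hbK, hb⟩
  have hl : l ≤ k := hKk _ hbK
  refine Set.mem_iInter.1 hqK ⟨l, Nat.lt_succ_of_le hl⟩ ?_
  change (⟨l, G.initSeg l k hl q⟩ : G.FinPath) ∈ K
  rwa [← hb.eq_initSeg hq hl]
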